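/- Let n ≥ 1 and let T be a natural 2-covariant tensor associated to a Lorentzian metric and a 2-form on open subsets of ℝ^{1+n}. If T satisfies: (1) independence of the unit of scale, i.e. T(λ²g, λF) = T(g,F) for every λ > 0; (2) for every point x, F_x = 0 implies T(g,F)_x = 0; and (3) whenever dF = 0 one has div_g T(g,F) = − i_{∂_g F} F; then T(g,F) is the electromagnetic energy tensor, given in coordinates by T_{ab} = −( F_a{}^i F_{bi} − (1/4) F^{ij} F_{ij} g_{ab} ), all indices raised with g. -/

import Mathlib

namespace Paper

noncomputable section

/-- Points of `ℝ^{1+n}`. -/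
abbrev Pt (n : ℕ) := Fin (n + 1) → ℝ

/-- Partial derivative `∂_a f` of a scalar function. -/
def pd (n : ℕ) (a : Fin (n + 1)) (f : Pt n → ℝ) (x : Pt n) : ℝ :=
  fderiv ℝ f x (Pi.single a 1)

/-- The signs `ε₀ = 1`, `ε_i = -1` for `i ≠ 0`. -/
def eps (n : ℕ) (i : Fin (n + 1)) : ℝ := if i = 0 then 1 else -1

/-- The standard Minkowski matrix `diag(1, -1, …, -1)`. -/
def minkM (n : ℕ) (a b : Fin (n + 1)) : ℝ := if a = b then eps n a else 0

/-- Prepend an entry to an index tuple: `(a, v₁, …, v_{k-1})`. -/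
def dcons {α : Type*} (k : ℕ) (a : α) (v : Fin (k - 1) → α) : Fin k → α :=
  fun j => if h : (j : ℕ) = 0 then a else v ⟨(j : ℕ) - 1, by have := j.isLt; omega⟩

/-- Append an entry to an index tuple: `(v₁, …, v_{k-1}, b)`. -/
def dsnoc {α : Type*} (k : ℕ) (v : Fin (k - 1) → α) (b : α) : Fin k → α :=
  fun j => if h : (j : ℕ) < k - 1 then v ⟨(j : ℕ), h⟩ else b

/-- `g` (given by its components) is a Lorentzian metric on the open set `W`:
it is smooth on `W` and, at each point of `W`, a symmetric bilinear form of
signature `(1,n)` (i.e. congruent to the Minkowski matrix). -/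
def IsMetricOn (n : ℕ) (W : Set (Pt n)) (g : Pt n → Fin (n + 1) → Fin (n + 1) → ℝ) : Prop :=
  (∀ a b, ContDiffOn ℝ (⊤ : ℕ∞) (fun x => g x a b) W) ∧
  (∀ x ∈ W, (∀ a b, g x a b = g x b a) ∧
    ∃ P : Matrix (Fin (n + 1)) (Fin (n + 1)) ℝ, IsUnit P.det ∧
      ∀ a b, (∑ c, ∑ d, P c a * g x c d * P d b) = minkM n a b)

/-- `ω` (given by its components) is a smooth `k`-form field on the open set `W`. -/
def IsFormOn (n k : ℕ) (W : Set (Pt n)) (ω : Pt n → (Fin k → Fin (n + 1)) → ℝ) : Prop :=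
  (∀ v, ContDiffOn ℝ (⊤ : ℕ∞) (fun x => ω x v) W) ∧
  (∀ x ∈ W, ∀ (v : Fin k → Fin (n + 1)) (σ : Equiv.Perm (Fin k)),
    ω x (v ∘ σ) = ((Equiv.Perm.sign σ : ℤ) : ℝ) * ω x v)

/-- `t` is a smooth 2-covariant tensor field on `W`. -/
def IsTensorFieldOn (n : ℕ) (W : Set (Pt n)) (t : Pt n → Fin (n + 1) → Fin (n + 1) → ℝ) : Prop :=
  ∀ a b, ContDiffOn ℝ (⊤ : ℕ∞) (fun x => t x a b) W

/-- `τ : W → W'` is a diffeomorphism between open subsets of `ℝ^{1+n}`, with inverse `σf`. -/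
structure IsDiffeoOn (n : ℕ) (τ σf : Pt n → Pt n) (W W' : Set (Pt n)) : Prop where
  open_src : IsOpen W
  open_tgt : IsOpen W'
  mapsTo : Set.MapsTo τ W W'
  mapsTo_inv : Set.MapsTo σf W' W
  left_inv : ∀ x ∈ W, σf (τ x) = x
  right_inv : ∀ y ∈ W', τ (σf y) = y
  smooth : ContDiffOn ℝ (⊤ : ℕ∞) τ W
  smooth_inv : ContDiffOn ℝ (⊤ : ℕ∞) σf W'

/-- The Jacobian matrix `(dτ_x)(e_a)_c` of a map `τ`. -/
def jac (n : ℕ) (τ : Pt n → Pt n) (x : Pt n) (a c : Fin (n + 1)) : ℝ :=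
  fderiv ℝ τ x (Pi.single a 1) c

/-- Pullback of a 2-covariant tensor field (in particular of a metric):
`(τ*g)_x(u,v) = g_{τ(x)}(dτ_x u, dτ_x v)`, componentwise. -/
def pullTensor (n : ℕ) (τ : Pt n → Pt n) (g : Pt n → Fin (n + 1) → Fin (n + 1) → ℝ) :
    Pt n → Fin (n + 1) → Fin (n + 1) → ℝ :=
  fun x a b => ∑ c, ∑ d, jac n τ x a c * jac n τ x b d * g (τ x) c d

/-- Pullback of a `k`-form field, componentwise. -/
def pullForm (n k : ℕ) (τ : Pt n → Pt n) (ω : Pt n → (Fin k → Fin (n + 1)) → ℝ) :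
    Pt n → (Fin k → Fin (n + 1)) → ℝ :=
  fun x v => ∑ w : Fin k → Fin (n + 1), (∏ j, jac n τ x (v j) (w j)) * ω (τ x) w

/-- A natural 2-covariant tensor `T(g,ω)` associated to a Lorentzian metric and a `k`-form
on open subsets of `ℝ^{1+n}`: a rule assigning to every open `W` and every pair `(g,ω)` on
`W` a 2-covariant tensor field `T(g,ω)` on `W` that commutes with restrictions, is
equivariant under diffeomorphisms between open subsets, and is regular (smooth families of
data yield smooth families of values). -/
structure NaturalTensor (n k : ℕ) where
  T : Set (Pt n) → (Pt n → Fin (n + 1) → Fin (n + 1) → ℝ) →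
      (Pt n → (Fin k → Fin (n + 1)) → ℝ) → (Pt n → Fin (n + 1) → Fin (n + 1) → ℝ)
  smooth : ∀ W g ω, IsOpen W → IsMetricOn n W g → IsFormOn n k W ω →
      IsTensorFieldOn n W (T W g ω)
  localize : ∀ W₁ W₂ g₁ ω₁ g₂ ω₂, IsOpen W₁ → IsOpen W₂ → W₁ ⊆ W₂ →
      IsMetricOn n W₁ g₁ → IsFormOn n k W₁ ω₁ →
      IsMetricOn n W₂ g₂ → IsFormOn n k W₂ ω₂ →
      (∀ x ∈ W₁, g₁ x = g₂ x ∧ ω₁ x = ω₂ x) →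
      ∀ x ∈ W₁, T W₁ g₁ ω₁ x = T W₂ g₂ ω₂ x
  natural : ∀ τ σf W W', IsDiffeoOn n τ σf W W' →
      ∀ g ω, IsMetricOn n W' g → IsFormOn n k W' ω →
      ∀ x ∈ W, ∀ a b, T W (pullTensor n τ g) (pullForm n k τ ω) x a b =
        pullTensor n τ (T W' g ω) x a b
  regular : ∀ (m : ℕ) (P : Set (Fin m → ℝ)) (W : Set (Pt n)), IsOpen P → IsOpen W →
      ∀ (g : (Fin m → ℝ) → Pt n → Fin (n + 1) → Fin (n + 1) → ℝ)
        (ω : (Fin m → ℝ) → Pt n → (Fin k → Fin (n + 1)) → ℝ),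
      (∀ a b, ContDiffOn ℝ (⊤ : ℕ∞)
        (fun p : (Fin m → ℝ) × Pt n => g p.1 p.2 a b) (P ×ˢ W)) →
      (∀ v, ContDiffOn ℝ (⊤ : ℕ∞)
        (fun p : (Fin m → ℝ) × Pt n => ω p.1 p.2 v) (P ×ˢ W)) →
      (∀ s ∈ P, IsMetricOn n W (g s) ∧ IsFormOn n k W (ω s)) →
      ∀ a b, ContDiffOn ℝ (⊤ : ℕ∞)
        (fun p : (Fin m → ℝ) × Pt n => T W (g p.1) (ω p.1) p.2 a b) (P ×ˢ W)

/-- The inverse metric `g^{ab}` at a point. -/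
def ginv (n : ℕ) (g : Pt n → Fin (n + 1) → Fin (n + 1) → ℝ) (x : Pt n) :
    Matrix (Fin (n + 1)) (Fin (n + 1)) ℝ :=
  (Matrix.of fun a b => g x a b)⁻¹

/-- The Christoffel symbols
`Γ^c_{ab} = (1/2) g^{cd}(∂_a g_{db} + ∂_b g_{da} − ∂_d g_{ab})`. -/
def christoffel (n : ℕ) (g : Pt n → Fin (n + 1) → Fin (n + 1) → ℝ) (x : Pt n)
    (c a b : Fin (n + 1)) : ℝ :=
  (1 / 2) * ∑ d, ginv n g x c d *
    (pd n a (fun y => g y d b) x + pd n b (fun y => g y d a) x - pd n d (fun y => g y a b) x)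

/-- The divergence of a 2-covariant tensor field: `(div_g t)_b = g^{ac} ∇_a t_{cb}`. -/
def divT (n : ℕ) (g t : Pt n → Fin (n + 1) → Fin (n + 1) → ℝ) (x : Pt n)
    (b : Fin (n + 1)) : ℝ :=
  ∑ a, ∑ c, ginv n g x a c *
    (pd n a (fun y => t y c b) x - (∑ e, christoffel n g x e a c * t x e b)
      - (∑ e, christoffel n g x e a b * t x c e))

/-- The covariant derivative `∇_a ω_{v₁…v_k}` of a `k`-form field. -/
def covd (n k : ℕ) (g : Pt n → Fin (n + 1) → Fin (n + 1) → ℝ)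
    (ω : Pt n → (Fin k → Fin (n + 1)) → ℝ) (x : Pt n) (a : Fin (n + 1))
    (v : Fin k → Fin (n + 1)) : ℝ :=
  pd n a (fun y => ω y v) x -
    ∑ l : Fin k, ∑ e, christoffel n g x e a (v l) * ω x (Function.update v l e)

/-- The codifferential `(∂_g ω)_{i₁…i_{k−1}} = −g^{ab} ∇_a ω_{b i₁…i_{k−1}}`. -/
def codiff (n k : ℕ) (g : Pt n → Fin (n + 1) → Fin (n + 1) → ℝ)
    (ω : Pt n → (Fin k → Fin (n + 1)) → ℝ) (x : Pt n)
    (v : Fin (k - 1) → Fin (n + 1)) : ℝ :=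
  -∑ a, ∑ b, ginv n g x a b * covd n k g ω x a (dcons k b v)

/-- The exterior differential `(dω)_{i₀…i_k} = Σ_j (−1)^j ∂_{i_j} ω_{i₀…î_j…i_k}`. -/
def dext (n k : ℕ) (ω : Pt n → (Fin k → Fin (n + 1)) → ℝ) (x : Pt n)
    (u : Fin (k + 1) → Fin (n + 1)) : ℝ :=
  ∑ j : Fin (k + 1), (-1 : ℝ) ^ (j : ℕ) * pd n (u j) (fun y => ω y (u ∘ j.succAbove)) x

/-- `(i_{∂_g ω} ω)_b = (1/(k−1)!) (∂_g ω)^{i₂…i_k} ω_{i₂…i_k b}`, indices raised with `g`. -/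
def iCodiff (n k : ℕ) (g : Pt n → Fin (n + 1) → Fin (n + 1) → ℝ)
    (ω : Pt n → (Fin k → Fin (n + 1)) → ℝ) (x : Pt n) (b : Fin (n + 1)) : ℝ :=
  (1 / ((k - 1).factorial : ℝ)) *
    ∑ v : Fin (k - 1) → Fin (n + 1), ∑ w : Fin (k - 1) → Fin (n + 1),
      (∏ j, ginv n g x (v j) (w j)) * codiff n k g ω x v * ω x (dsnoc k w b)

/-- The scalar product `⟨ω,ω⟩_g = (1/k!) ω^{i₁…i_k} ω_{i₁…i_k}`, indices raised with `g`. -/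
def scalarSq (n k : ℕ) (g : Pt n → Fin (n + 1) → Fin (n + 1) → ℝ)
    (ω : Pt n → (Fin k → Fin (n + 1)) → ℝ) (x : Pt n) : ℝ :=
  (1 / (k.factorial : ℝ)) * ∑ v : Fin k → Fin (n + 1), ∑ w : Fin k → Fin (n + 1),
    (∏ j, ginv n g x (v j) (w j)) * ω x v * ω x w

/-- The components of the 2-covariant tensor `⟨i_−ω, i_−ω⟩_g`:
`(1/(k−1)!) ω_a{}^{i₂…i_k} ω_{b i₂…i_k}`, indices raised with `g`. -/
def iiInner (n k : ℕ) (g : Pt n → Fin (n + 1) → Fin (n + 1) → ℝ)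
    (ω : Pt n → (Fin k → Fin (n + 1)) → ℝ) (x : Pt n) (a b : Fin (n + 1)) : ℝ :=
  (1 / ((k - 1).factorial : ℝ)) *
    ∑ v : Fin (k - 1) → Fin (n + 1), ∑ w : Fin (k - 1) → Fin (n + 1),
      (∏ j, ginv n g x (v j) (w j)) * ω x (dcons k a v) * ω x (dcons k b w)

/-- The energy tensor `E(g,ω) = (−1)^{k−1}(⟨i_−ω,i_−ω⟩_g − (1/2)⟨ω,ω⟩_g g)`. -/
def energyTensor (n k : ℕ) (g : Pt n → Fin (n + 1) → Fin (n + 1) → ℝ)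
    (ω : Pt n → (Fin k → Fin (n + 1)) → ℝ) (x : Pt n) (a b : Fin (n + 1)) : ℝ :=
  (-1 : ℝ) ^ (k - 1) *
    (iiInner n k g ω x a b - (1 / 2) * scalarSq n k g ω x * g x a b)

/-- The Ricci tensor
`Ricci_{ab} = ∂_c Γ^c_{ab} − ∂_a Γ^c_{cb} + Γ^c_{cd} Γ^d_{ab} − Γ^c_{ad} Γ^d_{cb}`. -/
def ricci (n : ℕ) (g : Pt n → Fin (n + 1) → Fin (n + 1) → ℝ) (x : Pt n)
    (a b : Fin (n + 1)) : ℝ :=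
  (∑ c, pd n c (fun y => christoffel n g y c a b) x)
  - (∑ c, pd n a (fun y => christoffel n g y c c b) x)
  + (∑ c, ∑ d, christoffel n g x c c d * christoffel n g x d a b)
  - (∑ c, ∑ d, christoffel n g x c a d * christoffel n g x d c b)

/-- The scalar curvature `r(g) = g^{ab} Ricci_{ab}`. -/
def scalarCurv (n : ℕ) (g : Pt n → Fin (n + 1) → Fin (n + 1) → ℝ) (x : Pt n) : ℝ :=
  ∑ a, ∑ b, ginv n g x a b * ricci n g x a b

end

end Paper

namespace Paper
/-- A smooth function that is homogeneous of degree two near the origin is a quadratic form. -/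
theorem exists_bilin_of_homogeneous {E : Type*} [NormedAddCommGroup E] [NormedSpace ℝ E]
    {f : E → ℝ} {P : Set E} (hP : IsOpen P) (h0 : (0 : E) ∈ P)
    (hf : ContDiffOn ℝ (⊤ : ℕ∞) f P)
    (hom : ∀ s ∈ P, ∀ t : ℝ, 0 < t → t ≤ 1 → f (t • s) = t ^ 2 * f s) :
    ∃ Q : E →L[ℝ] E →L[ℝ] ℝ, (∀ u v, Q u v = Q v u) ∧ ∀ s ∈ P, f s = Q s s := by
  have hc : ContDiffAt ℝ 2 f 0 :=
    ((hf.contDiffAt (hP.mem_nhds h0)).of_le (WithTop.coe_le_coe.2 le_top))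
  have hG : DifferentiableAt ℝ (fderiv ℝ f) 0 :=
    (hc.fderiv_right (m := 1) (by norm_num)).differentiableAt (by norm_num)
  refine ⟨(1 / 2 : ℝ) • fderiv ℝ (fderiv ℝ f) 0, fun u v => ?_, fun v hv => ?_⟩
  · have := hc.isSymmSndFDerivAt (by simp) u v
    simp [this]
  have hline : ∀ t : ℝ, HasDerivAt (fun t : ℝ => t • v) v t := fun t => by
    simpa using (hasDerivAt_id t).smul_const v
  have hψ : HasDerivAt (fun t : ℝ => fderiv ℝ f (t • v) v) (fderiv ℝ (fderiv ℝ f) 0 v v) 0 := by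
    have h1 : HasFDerivAt (fderiv ℝ f) (fderiv ℝ (fderiv ℝ f) 0) ((0 : ℝ) • v) := by
      simpa using hG.hasFDerivAt
    have h2 := h1.comp_hasDerivAt (0 : ℝ) (hline 0)
    exact (ContinuousLinearMap.apply ℝ ℝ v).hasFDerivAt.comp_hasDerivAt (0 : ℝ) h2
  have hPt : ∀ᶠ t : ℝ in nhds 0, t • v ∈ P := by
    have : ContinuousAt (fun t : ℝ => t • v) 0 := (hline 0).continuousAt
    exact this.eventually (by simpa using hP.mem_nhds h0)
  have hev : ∀ᶠ t : ℝ in nhdsWithin 0 (Set.Ioi 0),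
      fderiv ℝ f (t • v) v = 2 * t * f v := by
    filter_upwards [nhdsWithin_le_nhds hPt, self_mem_nhdsWithin,
      nhdsWithin_le_nhds (Iio_mem_nhds (zero_lt_one (α := ℝ)))] with t ht ht0 ht1
    have hd : DifferentiableAt ℝ f (t • v) :=
      (hf.contDiffAt (hP.mem_nhds ht)).differentiableAt (by simp)
    have h1 := hd.hasFDerivAt.comp_hasDerivAt t (hline t)
    have h2 : HasDerivAt (fun s : ℝ => s ^ 2 * f v) (2 * t * f v) t := by
      simpa using (hasDerivAt_pow 2 t).mul_const (f v)
    refine h1.unique (h2.congr_of_eventuallyEq ?_)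
    filter_upwards [Ioo_mem_nhds ht0 ht1] with s hs
    exact hom v hv s hs.1 hs.2.le
  have hlin : HasDerivWithinAt (fun t : ℝ => 2 * t * f v) (2 * f v) (Set.Ioi 0) 0 := by
    simpa using (((hasDerivAt_id (0 : ℝ)).const_mul 2).mul_const (f v)).hasDerivWithinAt
  have hzero : fderiv ℝ f ((0 : ℝ) • v) v = 2 * 0 * f v :=
    tendsto_nhds_unique (hψ.continuousAt.tendsto.mono_left nhdsWithin_le_nhds)
      (hlin.continuousWithinAt.tendsto.congr' (hev.mono fun t ht => ht.symm))
  have := (uniqueDiffWithinAt_Ioi (0 : ℝ)).eq_deriv _ hψ.hasDerivWithinAt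
    (hlin.congr_of_eventuallyEq hev hzero)
  simp [this]

/-- The elementary skew matrix `E_{ij} - E_{ji}`. -/
def skewUnit (n : ℕ) (i j : Fin (n + 1)) : Matrix (Fin (n + 1)) (Fin (n + 1)) ℝ :=
  fun k l => (if k = i ∧ l = j then 1 else 0) - (if k = j ∧ l = i then 1 else 0)

theorem skewUnit_skew (n : ℕ) (i j a b : Fin (n + 1)) :
    skewUnit n i j a b = -skewUnit n i j b a := by
  simp only [skewUnit, and_comm, neg_sub]

theorem skewUnit_swap (n : ℕ) (i j : Fin (n + 1)) : skewUnit n j i = -skewUnit n i j := by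
  ext k l
  simp [skewUnit]

theorem skew_eq_sum (n : ℕ) (F : Matrix (Fin (n + 1)) (Fin (n + 1)) ℝ)
    (hF : ∀ i j, F i j = -F j i) :
    F = ∑ i, ∑ j, (F i j / 2) • skewUnit n i j := by
  ext k l
  simp only [Matrix.sum_apply, Matrix.smul_apply, skewUnit, smul_eq_mul, mul_sub, mul_ite,
    mul_one, mul_zero, Finset.sum_sub_distrib, ite_and]
  simp only [Finset.sum_ite_irrel, Finset.sum_ite_eq, Finset.mem_univ, if_true,
    Finset.sum_const_zero]
  linarith [hF k l]

theorem eps_mul_self (n : ℕ) (i : Fin (n + 1)) : eps n i * eps n i = 1 := by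
  unfold eps; split_ifs <;> norm_num

/-- The polarization of the electromagnetic energy tensor of Minkowski space. -/
noncomputable def energyForm (n : ℕ) (a b : Fin (n + 1))
    (F G : Matrix (Fin (n + 1)) (Fin (n + 1)) ℝ) : ℝ :=
  -(1 / 2) * ∑ i, eps n i * (F a i * G b i + G a i * F b i)
    + (1 / 4) * (∑ i, ∑ j, eps n i * eps n j * F i j * G i j) * minkM n a b

theorem energyForm_comm (n : ℕ) (a b : Fin (n + 1))
    (F G : Matrix (Fin (n + 1)) (Fin (n + 1)) ℝ) :
    energyForm n a b F G = energyForm n a b G F := by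
  simp only [energyForm, mul_assoc, mul_comm (G _ _), add_comm (F a _ * G b _)]

/-- `energyForm` as a bilinear map. -/
noncomputable def energyBilin (n : ℕ) (a b : Fin (n + 1)) :
    Matrix (Fin (n + 1)) (Fin (n + 1)) ℝ →ₗ[ℝ] Matrix (Fin (n + 1)) (Fin (n + 1)) ℝ →ₗ[ℝ] ℝ :=
  have hadd : ∀ F G H, energyForm n a b F (G + H) =
      energyForm n a b F G + energyForm n a b F H := fun F G H => by
    simp only [energyForm, Matrix.add_apply, mul_add, add_mul, Finset.sum_add_distrib]
    ring
  have hsmul : ∀ (c : ℝ) F G, energyForm n a b F (c • G) = c * energyForm n a b F G :=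
    fun c F G => by
      simp only [energyForm, Matrix.smul_apply, smul_eq_mul, mul_add, Finset.mul_sum,
        Finset.sum_mul]
      congr 1
      · refine Finset.sum_congr rfl fun i _ => ?_; ring
      · refine Finset.sum_congr rfl fun i _ => Finset.sum_congr rfl fun j _ => ?_; ring
  LinearMap.mk₂ ℝ (energyForm n a b)
    (fun F G H => by rw [energyForm_comm, hadd, energyForm_comm, energyForm_comm n a b H])
    (fun c F G => by rw [energyForm_comm, hsmul, energyForm_comm, smul_eq_mul])
    hadd (fun c F G => by rw [hsmul, smul_eq_mul])

theorem energyBilin_apply (n : ℕ) (a b : Fin (n + 1))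
    (F G : Matrix (Fin (n + 1)) (Fin (n + 1)) ℝ) :
    energyBilin n a b F G = energyForm n a b F G := rfl

theorem energyForm_skewUnit_right (n : ℕ) (a b i j : Fin (n + 1))
    (F : Matrix (Fin (n + 1)) (Fin (n + 1)) ℝ) (hF : ∀ i j, F i j = -F j i) :
    energyForm n a b F (skewUnit n i j) =
      -(1 / 2) * ((if b = i then eps n j * F a j else 0) - (if b = j then eps n i * F a i else 0)
        + (if a = i then eps n j * F b j else 0) - (if a = j then eps n i * F b i else 0))
      + (1 / 2) * (eps n i * eps n j * F i j) * minkM n a b := by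
  simp only [energyForm, skewUnit, mul_add, mul_sub, sub_mul, mul_ite, ite_mul, mul_one, mul_zero,
    one_mul, zero_mul, Finset.sum_add_distrib, Finset.sum_sub_distrib, ite_and]
  simp only [Finset.sum_ite_irrel, Finset.sum_ite_eq', Finset.mem_univ, if_true,
    Finset.sum_const_zero]
  rw [hF j i]
  split_ifs <;> ring

/-- Bilinear forms with the symmetries and divergence identities of the energy tensor agree
with it on skew matrices. -/
theorem eq_energyForm (n : ℕ)
    (β : Fin (n + 1) → Fin (n + 1) → Matrix (Fin (n + 1)) (Fin (n + 1)) ℝ →ₗ[ℝ]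
      Matrix (Fin (n + 1)) (Fin (n + 1)) ℝ →ₗ[ℝ] ℝ)
    (symm : ∀ a b F G, β a b F G = β a b G F)
    (hdiv : ∀ (F : Matrix (Fin (n + 1)) (Fin (n + 1)) ℝ)
      (H : Fin (n + 1) → Matrix (Fin (n + 1)) (Fin (n + 1)) ℝ),
      (∀ i j, F i j = -F j i) → (∀ c i j, H c i j = -H c j i) →
      (∀ c i j, H c i j + H i j c + H j c i = 0) → ∀ b,
      2 * ∑ a, eps n a * β a b F (H a) = ∑ a, ∑ j, eps n a * eps n j * H a a j * F j b)
    (hrefl : ∀ r a b, a ≠ r → b ≠ r → ∀ F : Matrix (Fin (n + 1)) (Fin (n + 1)) ℝ,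
      (∀ i j, F i j = -F j i) →
      β a b (.of fun i j => (if i = r then -1 else 1) * (if j = r then -1 else 1) * F i j)
        (.of fun i j => (if i = r then -1 else 1) * (if j = r then -1 else 1) * F i j) = β a b F F)
    (F : Matrix (Fin (n + 1)) (Fin (n + 1)) ℝ) (hF : ∀ i j, F i j = -F j i)
    (a b : Fin (n + 1)) : β a b F F = energyForm n a b F F := by
  have eq_of_left : ∀ F : Matrix (Fin (n + 1)) (Fin (n + 1)) ℝ, (∀ i j, F i j = -F j i) →
      ∀ a b j, j ≠ a → β a b F (skewUnit n a j) = energyForm n a b F (skewUnit n a j) := by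
    intro F hF a b j hja
    have h := hdiv F (fun c => (if c = a then (1 : ℝ) else 0) • skewUnit n a j) hF
      (fun c i k => by simp only [Matrix.smul_apply, skewUnit_skew n a j i k, smul_neg])
      (fun c i k => by
        by_cases h1 : c = a <;> by_cases h2 : i = a <;> by_cases h3 : k = a <;>
          simp [h1, h2, h3, skewUnit, hja.symm]) b
    simp only [map_smul, smul_eq_mul, Matrix.smul_apply, ite_mul, one_mul, zero_mul, mul_ite,
      mul_zero, Finset.sum_ite_irrel, Finset.sum_ite_eq', Finset.mem_univ, if_true,
      Finset.sum_const_zero] at h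
    have h1 : ∀ l, skewUnit n a j a l = if l = j then 1 else 0 := fun l => by
      simp [skewUnit, hja.symm]
    simp only [h1, mul_ite, mul_one, mul_zero, ite_mul, zero_mul, Finset.sum_ite_eq',
      Finset.mem_univ, if_true] at h
    have hne : eps n a ≠ 0 := fun h => by simpa [h] using eps_mul_self n a
    refine mul_left_cancel₀ hne ?_
    rw [energyForm_skewUnit_right n a b a j F hF]
    have ha := eps_mul_self n a
    have hb := hF b j
    have haa := hF a a
    simp only [minkM]
    clear hdiv hrefl symm hF h1
    grind
  have exchange : ∀ F : Matrix (Fin (n + 1)) (Fin (n + 1)) ℝ, (∀ i j, F i j = -F j i) →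
      ∀ a b i j, i ≠ a → j ≠ a → i ≠ j →
      eps n a * β a b F (skewUnit n i j) + eps n i * β i b F (skewUnit n a j) = 0 := by
    intro F hF a b i j hia hja hij
    have h := hdiv F (fun c => (if c = a then (1 : ℝ) else 0) • skewUnit n i j +
        (if c = i then (1 : ℝ) else 0) • skewUnit n a j) hF
      (fun c k l => by
        simp only [Matrix.smul_apply, Matrix.add_apply, skewUnit_skew n a j k l,
          skewUnit_skew n i j k l, smul_neg, neg_add])
      (fun c k l => by
        simp only [Matrix.smul_apply, Matrix.add_apply, skewUnit, smul_eq_mul]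
        clear hdiv hrefl eq_of_left symm hF
        grind (splits := 30)) b
    simp only [map_add, map_smul, smul_eq_mul, Matrix.add_apply, Matrix.smul_apply, ite_mul,
      one_mul, zero_mul, mul_add, add_mul, mul_ite, mul_zero, Finset.sum_add_distrib,
      Finset.sum_ite_irrel, Finset.sum_ite_eq', Finset.mem_univ, if_true,
      Finset.sum_const_zero] at h
    have h1 : ∀ l, skewUnit n i j a l = 0 := fun l => by simp [skewUnit, hia.symm, hja.symm]
    have h2 : ∀ l, skewUnit n a j i l = 0 := fun l => by simp [skewUnit, hia, hij]
    simp only [h1, h2, mul_zero, zero_mul, Finset.sum_const_zero] at h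
    linarith
  have exchange' : ∀ F : Matrix (Fin (n + 1)) (Fin (n + 1)) ℝ, (∀ i j, F i j = -F j i) →
      ∀ a b i j, i ≠ a → j ≠ a → i ≠ j →
      eps n a * energyForm n a b F (skewUnit n i j) +
        eps n i * energyForm n i b F (skewUnit n a j) = 0 := by
    intro F hF a b i j hia hja hij
    rw [energyForm_skewUnit_right n a b i j F hF, energyForm_skewUnit_right n i b a j F hF]
    have ha := eps_mul_self n a
    have hi := eps_mul_self n i
    have hj := hF i j
    have hj' := hF a i
    simp only [minkM]
    clear hdiv hrefl symm exchange eq_of_left hF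
    grind
  have comm : ∀ {a b k l i j}, β a b (skewUnit n k l) (skewUnit n i j) =
        energyForm n a b (skewUnit n k l) (skewUnit n i j) →
      β a b (skewUnit n i j) (skewUnit n k l) =
        energyForm n a b (skewUnit n i j) (skewUnit n k l) := by
    intro a b k l i j h
    rw [symm, h, energyForm_comm]
  have swap : ∀ {a b k l i j}, β a b (skewUnit n k l) (skewUnit n i j) =
        energyForm n a b (skewUnit n k l) (skewUnit n i j) →
      β a b (skewUnit n k l) (skewUnit n j i) =
        energyForm n a b (skewUnit n k l) (skewUnit n j i) := by
    intro a b k l i j h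
    rw [skewUnit_swap n i j, ← energyBilin_apply, map_neg, map_neg, h, energyBilin_apply]
  have diag : ∀ a b k l i, β a b (skewUnit n k l) (skewUnit n i i) =
        energyForm n a b (skewUnit n k l) (skewUnit n i i) := by
    intro a b k l i
    have : skewUnit n i i = 0 := by ext k l; simp [skewUnit]
    rw [this, ← energyBilin_apply, map_zero, map_zero]
  have left : ∀ a b k l j, β a b (skewUnit n k l) (skewUnit n a j) =
        energyForm n a b (skewUnit n k l) (skewUnit n a j) := by
    intro a b k l j
    by_cases hj : j = a
    · rw [hj]; exact diag _ _ _ _ _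
    · exact eq_of_left _ (skewUnit_skew n k l) a b j hj
  have common : ∀ a b l i j, i ≠ a → j ≠ a →
      β a b (skewUnit n i l) (skewUnit n i j) =
        energyForm n a b (skewUnit n i l) (skewUnit n i j) := by
    intro a b l i j hia hja
    by_cases hij : i = j
    · rw [hij]; exact diag _ _ _ _ _
    · have h1 := exchange _ (skewUnit_skew n i l) a b i j hia hja hij
      have h2 := exchange' _ (skewUnit_skew n i l) a b i j hia hja hij
      rw [comm (left i b a j l)] at h1
      have ha : eps n a ≠ 0 := fun h => by simpa [h] using eps_mul_self n a
      exact mul_left_cancel₀ ha (by linarith)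
  have refl_zero : ∀ a b k l r j, a ≠ r → b ≠ r → k ≠ r → l ≠ r → j ≠ r →
      β a b (skewUnit n k l) (skewUnit n r j) = 0 := by
    intro a b k l r j ha hb hk hl hj
    have h := hrefl r a b ha hb (skewUnit n k l + skewUnit n r j) (fun p q => by
      rw [Matrix.add_apply, skewUnit_skew, skewUnit_skew n r j p, Matrix.add_apply, neg_add])
    have hR : (Matrix.of fun p q => (if p = r then (-1 : ℝ) else 1) * (if q = r then -1 else 1) *
        (skewUnit n k l + skewUnit n r j) p q) = skewUnit n k l - skewUnit n r j := by
      ext p q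
      simp only [Matrix.of_apply, Matrix.add_apply, Matrix.sub_apply, skewUnit]
      grind
    rw [hR] at h
    simp only [map_add, map_sub, LinearMap.add_apply, LinearMap.sub_apply,
      symm a b (skewUnit n r j) (skewUnit n k l)] at h
    linarith
  have key : ∀ k l i j, β a b (skewUnit n k l) (skewUnit n i j) =
      energyForm n a b (skewUnit n k l) (skewUnit n i j) := by
    intro k l i j
    by_cases hai : i = a
    · rw [hai]; exact left _ _ _ _ _
    by_cases haj : j = a
    · rw [haj]; exact swap (left _ _ _ _ _)
    by_cases hak : k = a
    · rw [hak]; exact comm (left _ _ _ _ _)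
    by_cases hal : l = a
    · rw [hal]; exact comm (swap (left _ _ _ _ _))
    by_cases hki : k = i
    · rw [hki]; exact common _ _ _ _ _ hai haj
    by_cases hkj : k = j
    · rw [hkj]; exact swap (common _ _ _ _ _ haj hai)
    by_cases hli : l = i
    · rw [hli]; exact comm (swap (comm (common _ _ _ _ _ hai haj)))
    by_cases hlj : l = j
    · rw [hlj]; exact comm (swap (comm (swap (common _ _ _ _ _ haj hai))))
    by_cases hij : i = j
    · rw [hij]; exact diag _ _ _ _ _
    have hE : energyForm n a b (skewUnit n k l) (skewUnit n i j) = 0 := by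
      rw [energyForm_skewUnit_right n a b i j _ (skewUnit_skew n k l)]
      simp only [skewUnit]
      grind
    rw [hE]
    by_cases hbi : b = i
    · rw [skewUnit_swap n j i, map_neg, refl_zero a b k l j i (Ne.symm haj) (by grind) hkj hlj hij,
        neg_zero]
    · exact refl_zero a b k l i j (Ne.symm hai) hbi hki hli (Ne.symm hij)
  conv_lhs => rw [skew_eq_sum n F hF]
  conv_rhs => rw [skew_eq_sum n F hF]
  rw [← energyBilin_apply]
  simp only [map_sum, map_smul, LinearMap.sum_apply, LinearMap.smul_apply, key, energyBilin_apply]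

/-- For `k = 2`, the alternating condition only has to be checked on the transposition. -/
theorem isFormOn_two_iff {n : ℕ} {W : Set (Pt n)} {ω : Pt n → (Fin 2 → Fin (n + 1)) → ℝ} :
    IsFormOn n 2 W ω ↔ (∀ v, ContDiffOn ℝ (⊤ : ℕ∞) (fun x => ω x v) W) ∧
      ∀ x ∈ W, ∀ v, ω x (v ∘ Equiv.swap 0 1) = -ω x v := by
  refine and_congr_right fun _ => forall₂_congr fun x _ => forall_congr' fun v =>
    ⟨fun h => by simpa using h (Equiv.swap 0 1), fun h σ => ?_⟩
  have hσ : σ = 1 ∨ σ = Equiv.swap 0 1 := by decide +revert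
  rcases hσ with rfl | rfl
  · simp
  · simpa using h

theorem IsMetricOn.comp {n : ℕ} {W V : Set (Pt n)} {g : Pt n → Fin (n + 1) → Fin (n + 1) → ℝ}
    (hg : IsMetricOn n W g) {φ : Pt n → Pt n} (hφ : ContDiff ℝ (⊤ : ℕ∞) φ)
    (hmaps : Set.MapsTo φ V W) : IsMetricOn n V (fun y => g (φ y)) :=
  ⟨fun a b => (hg.1 a b).comp hφ.contDiffOn hmaps, fun _ hy => hg.2 _ (hmaps hy)⟩

theorem IsMetricOn.mono {n : ℕ} {W V : Set (Pt n)} {g : Pt n → Fin (n + 1) → Fin (n + 1) → ℝ}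
    (hg : IsMetricOn n W g) (h : V ⊆ W) : IsMetricOn n V g :=
  hg.comp contDiff_id h

theorem IsMetricOn.const {n : ℕ} {W : Set (Pt n)} {g : Pt n → Fin (n + 1) → Fin (n + 1) → ℝ}
    (hg : IsMetricOn n W g) {x : Pt n} (hx : x ∈ W) (V : Set (Pt n)) :
    IsMetricOn n V (fun _ => g x) :=
  hg.comp contDiff_const fun _ _ => hx

theorem IsFormOn.comp_smul {n : ℕ} {W V : Set (Pt n)} {F : Pt n → (Fin 2 → Fin (n + 1)) → ℝ}
    (hF : IsFormOn n 2 W F) (c : ℝ) {φ : Pt n → Pt n} (hφ : ContDiff ℝ (⊤ : ℕ∞) φ)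
    (hmaps : Set.MapsTo φ V W) : IsFormOn n 2 V (fun y v => c * F (φ y) v) := by
  rw [isFormOn_two_iff] at hF ⊢
  exact ⟨fun v => contDiffOn_const.mul ((hF.1 v).comp hφ.contDiffOn hmaps),
    fun y hy v => by rw [hF.2 _ (hmaps hy), mul_neg]⟩

theorem IsFormOn.mono {n : ℕ} {W V : Set (Pt n)} {F : Pt n → (Fin 2 → Fin (n + 1)) → ℝ}
    (hF : IsFormOn n 2 W F) (h : V ⊆ W) : IsFormOn n 2 V F := by
  simpa using hF.comp_smul 1 contDiff_id h

theorem IsFormOn.const {n : ℕ} {W : Set (Pt n)} {F : Pt n → (Fin 2 → Fin (n + 1)) → ℝ}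
    (hF : IsFormOn n 2 W F) {x : Pt n} (hx : x ∈ W) (V : Set (Pt n)) :
    IsFormOn n 2 V (fun _ => F x) := by
  simpa using hF.comp_smul 1 (φ := fun _ => x) contDiff_const fun _ _ => hx

/-- The affine map with linear part `M` sending `p` to `q`. -/
def affineMap (n : ℕ) (M : Matrix (Fin (n + 1)) (Fin (n + 1)) ℝ) (p q : Pt n) : Pt n → Pt n :=
  fun y => q + M.mulVec (y - p)

theorem affineMap_contDiff (n : ℕ) (M : Matrix (Fin (n + 1)) (Fin (n + 1)) ℝ) (p q : Pt n) :
    ContDiff ℝ (⊤ : ℕ∞) (affineMap n M p q) :=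
  contDiff_const.add ((Matrix.mulVecLin M).toContinuousLinearMap.contDiff.comp
    (contDiff_id.sub contDiff_const))

theorem jac_affineMap (n : ℕ) (M : Matrix (Fin (n + 1)) (Fin (n + 1)) ℝ) (p q x : Pt n)
    (a c : Fin (n + 1)) : jac n (affineMap n M p q) x a c = M c a := by
  have h : HasFDerivAt (affineMap n M p q) (Matrix.mulVecLin M).toContinuousLinearMap x := by
    have h1 := ((Matrix.mulVecLin M).toContinuousLinearMap.hasFDerivAt (x := x - p)).comp x
      ((hasFDerivAt_id x).sub_const p)
    exact h1.const_add q
  simp [jac, h.fderiv]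

theorem isDiffeoOn_affineMap (n : ℕ) {M : Matrix (Fin (n + 1)) (Fin (n + 1)) ℝ}
    (hM : IsUnit M.det) (p q : Pt n) {W' : Set (Pt n)} (hW' : IsOpen W') :
    IsDiffeoOn n (affineMap n M p q) (affineMap n M⁻¹ q p) (affineMap n M p q ⁻¹' W') W' := by
  have hr : ∀ y, affineMap n M p q (affineMap n M⁻¹ q p y) = y := fun y => by
    simp [affineMap, Matrix.mul_nonsing_inv M hM]
  exact
    { open_src := hW'.preimage (affineMap_contDiff n M p q).continuous
      open_tgt := hW'
      mapsTo := fun _ h => h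
      mapsTo_inv := fun y hy => by rwa [Set.mem_preimage, hr]
      left_inv := fun y _ => by simp [affineMap, Matrix.nonsing_inv_mul M hM]
      right_inv := fun y _ => hr y
      smooth := (affineMap_contDiff n M p q).contDiffOn
      smooth_inv := (affineMap_contDiff n M⁻¹ q p).contDiffOn }

theorem NaturalTensor.natural_affineMap {n : ℕ} (T : NaturalTensor n 2)
    {M : Matrix (Fin (n + 1)) (Fin (n + 1)) ℝ} (hM : IsUnit M.det) (p q : Pt n)
    {W' : Set (Pt n)} (hW' : IsOpen W') {g : Pt n → Fin (n + 1) → Fin (n + 1) → ℝ}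
    {F : Pt n → (Fin 2 → Fin (n + 1)) → ℝ} (hg : IsMetricOn n W' g) (hF : IsFormOn n 2 W' F)
    (x : Pt n) (hx : affineMap n M p q x ∈ W') (a b : Fin (n + 1)) :
    T.T (affineMap n M p q ⁻¹' W')
      (fun y a b => ∑ c, ∑ d, M c a * M d b * g (affineMap n M p q y) c d)
      (fun y v => ∑ w : Fin 2 → Fin (n + 1), M (w 0) (v 0) * M (w 1) (v 1) *
        F (affineMap n M p q y) w) x a b =
      ∑ c, ∑ d, M c a * M d b * T.T W' g F (affineMap n M p q x) c d := by
  have h := T.natural _ _ _ _ (isDiffeoOn_affineMap n hM p q hW') g F hg hF x hx a b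
  unfold pullTensor pullForm at h
  simpa only [jac_affineMap, Fin.prod_univ_two] using h

theorem NaturalTensor.homothety {n : ℕ} (T : NaturalTensor n 2)
    (scale : ∀ W g F, IsOpen W → IsMetricOn n W g → IsFormOn n 2 W F →
      ∀ lam : ℝ, 0 < lam → ∀ x ∈ W, ∀ a b,
        T.T W (fun y c d => lam ^ 2 * g y c d) (fun y v => lam * F y v) x a b
          = T.T W g F x a b) (x : Pt n) {r : ℝ} (hr : 0 < r)
    {g : Pt n → Fin (n + 1) → Fin (n + 1) → ℝ}
    {F : Pt n → (Fin 2 → Fin (n + 1)) → ℝ} (hg : IsMetricOn n (Metric.ball x r) g)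
    (hF : IsFormOn n 2 (Metric.ball x r) F) {t : ℝ} (ht : t ≠ 0) (ht1 : |t| ≤ 1)
    (a b : Fin (n + 1)) :
    T.T (Metric.ball x r) (fun y => g (x + t • (y - x)))
      (fun y v => |t| * F (x + t • (y - x)) v) x a b = t ^ 2 * T.T (Metric.ball x r) g F x a b := by
  have habs : 0 < |t| := abs_pos.2 ht
  set W' := Metric.ball x (|t| * r) with hW'
  have hsub : W' ⊆ Metric.ball x r :=
    Metric.ball_subset_ball (by nlinarith)
  have hx' : x ∈ W' := Metric.mem_ball_self (by positivity)
  have haff : ∀ y, affineMap n (t • 1) x x y = x + t • (y - x) := fun y => by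
    simp [affineMap, Matrix.smul_mulVec]
  have hpre : affineMap n (t • 1) x x ⁻¹' W' = Metric.ball x r := by
    ext y
    simp [hW', haff, dist_eq_norm, norm_smul, habs]
  have hmaps : Set.MapsTo (fun y => x + t • (y - x)) (Metric.ball x r) (Metric.ball x r) :=
    fun y hy => hsub (by rw [← hpre, Set.mem_preimage, haff] at hy; exact hy)
  have hφ : ContDiff ℝ (⊤ : ℕ∞) (fun y : Pt n => x + t • (y - x)) := by fun_prop
  have h := T.natural_affineMap (M := t • 1) (by simp [ht]) x x
    Metric.isOpen_ball (hg.mono hsub) (hF.mono hsub) x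
    (by rwa [haff, sub_self, smul_zero, add_zero]) a b
  rw [← hW', hpre] at h
  have hM : ∀ c d, (t • (1 : Matrix (Fin (n + 1)) (Fin (n + 1)) ℝ)) c d =
      if c = d then t else 0 := fun c d => by simp [Matrix.one_apply]
  have hsum : ∀ (u : Fin (n + 1) → Fin (n + 1) → ℝ) a b, ∑ c, ∑ d,
      (t • (1 : Matrix (Fin (n + 1)) (Fin (n + 1)) ℝ)) c a *
      (t • (1 : Matrix (Fin (n + 1)) (Fin (n + 1)) ℝ)) d b * u c d = |t| ^ 2 * u a b := by
    intro u a b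
    simp [Matrix.one_apply, pow_two]
  have hsum' : ∀ (u : (Fin 2 → Fin (n + 1)) → ℝ) v, ∑ w : Fin 2 → Fin (n + 1),
      (t • (1 : Matrix (Fin (n + 1)) (Fin (n + 1)) ℝ)) (w 0) (v 0) *
      (t • (1 : Matrix (Fin (n + 1)) (Fin (n + 1)) ℝ)) (w 1) (v 1) * u w =
        |t| * (|t| * u v) := by
    intro u v
    rw [Finset.sum_eq_single v, ← mul_assoc, abs_mul_abs_self]
    · simp
    · intro w _ hw
      have : w 0 ≠ v 0 ∨ w 1 ≠ v 1 := by
        by_contra! hc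
        exact hw (funext (Fin.forall_fin_two.2 hc))
      rcases this with h | h <;> simp [Matrix.one_apply, h]
    · simp
  simp only [hsum, hsum', haff, sub_self, smul_zero, add_zero] at h
  rw [scale _ (fun y => g (x + t • (y - x))) (fun y v => |t| * F (x + t • (y - x)) v)
    Metric.isOpen_ball (hg.comp hφ hmaps) (hF.comp_smul _ hφ hmaps) _ habs _
    (Metric.mem_ball_self hr)] at h
  rw [h, sq_abs, T.localize W' _ g F g F Metric.isOpen_ball Metric.isOpen_ball hsub
    (hg.mono hsub) (hF.mono hsub) hg hF (fun _ _ => ⟨rfl, rfl⟩) x hx']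

/-- A scale invariant natural tensor vanishing with the form depends only on the values of the
metric and of the form at the point. -/
theorem NaturalTensor.eq_const {n : ℕ} (T : NaturalTensor n 2)
    (scale : ∀ W g F, IsOpen W → IsMetricOn n W g → IsFormOn n 2 W F →
      ∀ lam : ℝ, 0 < lam → ∀ x ∈ W, ∀ a b,
        T.T W (fun y c d => lam ^ 2 * g y c d) (fun y v => lam * F y v) x a b
          = T.T W g F x a b)
    (vanish : ∀ W g F, IsOpen W → IsMetricOn n W g → IsFormOn n 2 W F →
      ∀ x ∈ W, (∀ v, F x v = 0) → ∀ a b, T.T W g F x a b = 0)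
    {W : Set (Pt n)} {g : Pt n → Fin (n + 1) → Fin (n + 1) → ℝ}
    {F : Pt n → (Fin 2 → Fin (n + 1)) → ℝ} (hW : IsOpen W) (hg : IsMetricOn n W g)
    (hF : IsFormOn n 2 W F) {x : Pt n} (hx : x ∈ W) (a b : Fin (n + 1)) :
    T.T W g F x a b = T.T Set.univ (fun _ => g x) (fun _ => F x) x a b := by
  obtain ⟨R, hR, hRW⟩ := Metric.isOpen_iff.1 hW x hx
  set r := R / 2 with hr
  have hr0 : 0 < r := by positivity
  set B := Metric.ball x r with hB
  have hxB : x ∈ B := Metric.mem_ball_self hr0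
  have hBW : B ⊆ W := (Metric.ball_subset_ball (by linarith)).trans hRW
  set P : Set (Fin 2 → ℝ) := {s | |s 0| < 2} with hP
  have hPo : IsOpen P := isOpen_lt (by fun_prop) continuous_const
  have hmaps : ∀ l : ℝ, |l| < 2 → Set.MapsTo (fun y => x + l • (y - x)) B W := by
    intro l hl y hy
    apply hRW
    rw [hB, Metric.mem_ball, dist_eq_norm] at hy
    rw [Metric.mem_ball, dist_eq_norm, add_sub_cancel_left, norm_smul, Real.norm_eq_abs]
    nlinarith [abs_nonneg l, norm_nonneg (y - x)]
  have hφ : ∀ l : ℝ, ContDiff ℝ (⊤ : ℕ∞) (fun y : Pt n => x + l • (y - x)) := fun l => by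
    fun_prop
  have hgm : ∀ l : ℝ, |l| < 2 → IsMetricOn n B (fun y => g (x + l • (y - x))) :=
    fun l hl => hg.comp (hφ l) (hmaps l hl)
  have hFm : ∀ l : ℝ, |l| < 2 → ∀ c : ℝ, IsFormOn n 2 B (fun y v => c * F (x + l • (y - x)) v) :=
    fun l hl c => hF.comp_smul c (hφ l) (hmaps l hl)
  set f : (Fin 2 → ℝ) → ℝ := fun s =>
    T.T B (fun y => g (x + s 0 • (y - x))) (fun y v => s 1 * F (x + s 0 • (y - x)) v) x a b with hf
  have hinner : ContDiff ℝ (⊤ : ℕ∞) (fun p : (Fin 2 → ℝ) × Pt n => x + p.1 0 • (p.2 - x)) := by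
    fun_prop
  have hinnerm : Set.MapsTo (fun p : (Fin 2 → ℝ) × Pt n => x + p.1 0 • (p.2 - x)) (P ×ˢ B) W :=
    fun p hp => hmaps _ hp.1 hp.2
  have hsm := T.regular 2 P B hPo Metric.isOpen_ball
    (fun s y => g (x + s 0 • (y - x))) (fun s y v => s 1 * F (x + s 0 • (y - x)) v)
    (fun a b => (hg.1 a b).comp hinner.contDiffOn hinnerm)
    (fun v => (ContDiff.contDiffOn (by fun_prop)).mul ((hF.1 v).comp hinner.contDiffOn hinnerm))
    (fun s hs => ⟨hgm _ hs, hFm _ hs _⟩) a b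
  have hfs : ContDiffOn ℝ (⊤ : ℕ∞) f P :=
    hsm.comp (f := fun s => (s, x)) (ContDiff.contDiffOn (by fun_prop)) fun s hs => ⟨hs, hxB⟩
  have hom : ∀ s ∈ P, ∀ t : ℝ, t ≠ 0 → |t| ≤ 1 → f ![t * s 0, |t| * s 1] = t ^ 2 * f s := by
    intro s hs t ht ht1
    have h := T.homothety scale x hr0 (hgm _ hs) (hFm _ hs (s 1)) ht ht1 a b
    simp only [add_sub_cancel_left, smul_smul, ← mul_assoc] at h
    simp only [hf, ← h, Matrix.cons_val_zero, Matrix.cons_val_one, mul_comm t, hB]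
  obtain ⟨Q, hQ, hfQ⟩ := exists_bilin_of_homogeneous hPo (by simp [hP]) hfs (by
    intro s hs t ht ht1
    rw [← hom s hs t ht.ne' (by rwa [abs_of_pos ht]), abs_of_pos ht]
    congr 1
    ext i
    fin_cases i <;> simp)
  set u : Fin 2 → ℝ := ![1, 0] with hu
  set v : Fin 2 → ℝ := ![0, 1] with hv
  have h11 : f (u + v) = T.T B g F x a b := by simp [hf, hu, hv]
  have h01 : f v = T.T B (fun _ => g x) (fun _ => F x) x a b := by simp [hf, hv]
  have h10 : f u = 0 :=
    vanish _ _ _ Metric.isOpen_ball (hgm _ (by simp [hu])) (hFm _ (by simp [hu]) _) x hxB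
      (by simp [hu]) a b
  have hneg : f (-u + v) = f (u + v) := by
    have := hom (u + v) (by simp [hP, hu, hv]) (-1) (by norm_num) (by norm_num)
    simpa [hu, hv] using this
  have hmem : u ∈ P ∧ v ∈ P ∧ u + v ∈ P ∧ -u + v ∈ P := by simp [hP, hu, hv]
  obtain ⟨m1, m2, m3, m4⟩ := hmem
  rw [← T.localize B W g F g F Metric.isOpen_ball hW hBW (hg.mono hBW) (hF.mono hBW) hg hF
    (fun _ _ => ⟨rfl, rfl⟩) x hxB,
    ← T.localize B Set.univ (fun _ => g x) (fun _ => F x) _ _ Metric.isOpen_ball isOpen_univ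
    (Set.subset_univ _) (hg.const hx _) (hF.const hx _) (hg.const hx _) (hF.const hx _)
    (fun _ _ => ⟨rfl, rfl⟩) x hxB, ← h11, ← h01]
  rw [hfQ _ m3, hfQ _ m4] at hneg
  rw [hfQ _ m1] at h10
  rw [hfQ _ m3, hfQ _ m2]
  simp only [map_add, map_neg, add_apply, neg_apply] at *
  linarith [hQ u v]

/-- The components of the 2-form with matrix `A`. -/
def toForm (n : ℕ) (A : Matrix (Fin (n + 1)) (Fin (n + 1)) ℝ) (v : Fin 2 → Fin (n + 1)) : ℝ :=
  A (v 0) (v 1)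

theorem isFormOn_toForm {n : ℕ} {W : Set (Pt n)} {A : Pt n → Matrix (Fin (n + 1)) (Fin (n + 1)) ℝ}
    (hA : ∀ i j, ContDiffOn ℝ (⊤ : ℕ∞) (fun x => A x i j) W)
    (hskew : ∀ x ∈ W, ∀ i j, A x i j = -A x j i) :
    IsFormOn n 2 W (fun x => toForm n (A x)) := by
  rw [isFormOn_two_iff]
  exact ⟨fun v => hA _ _, fun x hx v => by simpa [toForm] using hskew x hx (v 1) (v 0)⟩

theorem isFormOn_const_toForm {n : ℕ} (W : Set (Pt n))
    {A : Matrix (Fin (n + 1)) (Fin (n + 1)) ℝ} (hA : ∀ i j, A i j = -A j i) :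
    IsFormOn n 2 W (fun _ => toForm n A) :=
  isFormOn_toForm (A := fun _ => A) (fun _ _ => contDiffOn_const) fun _ _ => hA

theorem eq_toForm {n : ℕ} (ω : (Fin 2 → Fin (n + 1)) → ℝ) :
    ω = toForm n (.of fun i j => ω ![i, j]) := by
  ext v
  have : ![v 0, v 1] = v := by ext i; fin_cases i <;> rfl
  simp [toForm, this]

theorem IsFormOn.skew {n : ℕ} {W : Set (Pt n)} {F : Pt n → (Fin 2 → Fin (n + 1)) → ℝ}
    (hF : IsFormOn n 2 W F) {x : Pt n} (hx : x ∈ W) (i j : Fin (n + 1)) :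
    F x ![i, j] = -F x ![j, i] := by
  rw [← (isFormOn_two_iff.1 hF).2 x hx]
  congr 1
  ext k
  fin_cases k <;> rfl

theorem minkM_comm (n : ℕ) (a b : Fin (n + 1)) : minkM n a b = minkM n b a := by
  unfold minkM
  split_ifs with h h' h'
  · rw [h]
  · exact absurd h.symm h'
  · exact absurd h'.symm h
  · rfl

theorem isMetricOn_minkM (n : ℕ) (W : Set (Pt n)) : IsMetricOn n W (fun _ => minkM n) :=
  ⟨fun _ _ => contDiffOn_const, fun _ _ => ⟨minkM_comm n, 1, by simp, fun a b => by
    simp [Matrix.one_apply]⟩⟩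

theorem sum_toForm {n : ℕ} (M A : Matrix (Fin (n + 1)) (Fin (n + 1)) ℝ)
    (v : Fin 2 → Fin (n + 1)) :
    ∑ w : Fin 2 → Fin (n + 1), M (w 0) (v 0) * M (w 1) (v 1) * toForm n A w =
      toForm n (.of fun i j => ∑ c, ∑ d, M c i * M d j * A c d) v := by
  rw [← (finTwoArrowEquiv (Fin (n + 1))).symm.sum_comp, Fintype.sum_prod_type]
  simp [toForm]

theorem NaturalTensor.natural_const {n : ℕ} (T : NaturalTensor n 2)
    {M : Matrix (Fin (n + 1)) (Fin (n + 1)) ℝ} (hM : IsUnit M.det) (p q : Pt n)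
    {g : Fin (n + 1) → Fin (n + 1) → ℝ} {A : Matrix (Fin (n + 1)) (Fin (n + 1)) ℝ}
    (hg : IsMetricOn n Set.univ (fun _ => g)) (hA : ∀ i j, A i j = -A j i) (a b : Fin (n + 1)) :
    T.T Set.univ (fun _ a b => ∑ c, ∑ d, M c a * M d b * g c d)
      (fun _ => toForm n (.of fun i j => ∑ c, ∑ d, M c i * M d j * A c d)) p a b =
      ∑ c, ∑ d, M c a * M d b * T.T Set.univ (fun _ => g) (fun _ => toForm n A) q c d := by
  have h := T.natural_affineMap hM p q isOpen_univ hg (isFormOn_const_toForm _ hA) p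
    (Set.mem_univ _) a b
  simp only [sum_toForm, Set.preimage_univ] at h
  rw [h]
  simp [affineMap]

theorem NaturalTensor.const_translation {n : ℕ} (T : NaturalTensor n 2) (p q : Pt n)
    {g : Fin (n + 1) → Fin (n + 1) → ℝ} {A : Matrix (Fin (n + 1)) (Fin (n + 1)) ℝ}
    (hg : IsMetricOn n Set.univ (fun _ => g)) (hA : ∀ i j, A i j = -A j i) (a b : Fin (n + 1)) :
    T.T Set.univ (fun _ => g) (fun _ => toForm n A) p a b =
      T.T Set.univ (fun _ => g) (fun _ => toForm n A) q a b := by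
  have h := T.natural_const (M := 1) (by simp) p q hg hA a b
  simp only [Matrix.one_apply, ite_mul, mul_ite, one_mul, mul_one, zero_mul, mul_zero,
    Finset.sum_ite_eq', Finset.mem_univ, if_true] at h
  exact h

/-- The value of a scale invariant natural tensor on constant data over Minkowski space is a
quadratic form in the 2-form. -/
theorem NaturalTensor.exists_bilin {n : ℕ} (T : NaturalTensor n 2)
    (scale : ∀ W g F, IsOpen W → IsMetricOn n W g → IsFormOn n 2 W F →
      ∀ lam : ℝ, 0 < lam → ∀ x ∈ W, ∀ a b,
        T.T W (fun y c d => lam ^ 2 * g y c d) (fun y v => lam * F y v) x a b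
          = T.T W g F x a b) (a b : Fin (n + 1)) :
    ∃ β : Matrix (Fin (n + 1)) (Fin (n + 1)) ℝ →ₗ[ℝ] Matrix (Fin (n + 1)) (Fin (n + 1)) ℝ →ₗ[ℝ] ℝ,
      (∀ F G, β F G = β G F) ∧ ∀ F : Matrix (Fin (n + 1)) (Fin (n + 1)) ℝ,
        (∀ i j, F i j = -F j i) →
          β F F = T.T Set.univ (fun _ => minkM n) (fun _ => toForm n F) 0 a b := by
  set e := Fintype.equivFin (Fin (n + 1) × Fin (n + 1))
  set m := Fintype.card (Fin (n + 1) × Fin (n + 1))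
  set A : (Fin m → ℝ) → Matrix (Fin (n + 1)) (Fin (n + 1)) ℝ := fun s =>
    .of fun i j => (s (e (i, j)) - s (e (j, i))) / 2 with hA
  have hskew : ∀ s i j, A s i j = -A s j i := fun s i j => by simp only [hA, Matrix.of_apply]; ring
  set f : (Fin m → ℝ) → ℝ := fun s =>
    T.T Set.univ (fun _ => minkM n) (fun _ => toForm n (A s)) 0 a b with hf
  have hsm := T.regular m Set.univ Set.univ isOpen_univ isOpen_univ
    (fun _ _ => minkM n) (fun s _ => toForm n (A s)) (fun _ _ => contDiffOn_const)
    (fun v => ContDiff.contDiffOn (by simp only [toForm, hA, Matrix.of_apply]; fun_prop))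
    (fun s _ => ⟨isMetricOn_minkM n _, isFormOn_const_toForm _ (hskew s)⟩) a b
  have hfs : ContDiffOn ℝ (⊤ : ℕ∞) f Set.univ :=
    hsm.comp (f := fun s => (s, 0)) (ContDiff.contDiffOn (by fun_prop)) fun s _ => by simp
  have hball : ∀ s, T.T (Metric.ball 0 1) (fun _ => minkM n) (fun _ => toForm n (A s)) 0 a b =
      f s := fun s => by
    rw [T.localize _ Set.univ _ _ (fun _ => minkM n) (fun _ => toForm n (A s)) Metric.isOpen_ball
      isOpen_univ (Set.subset_univ _) (isMetricOn_minkM n _) (isFormOn_const_toForm _ (hskew s))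
      (isMetricOn_minkM n _) (isFormOn_const_toForm _ (hskew s)) (fun _ _ => ⟨rfl, rfl⟩) 0
      (Metric.mem_ball_self one_pos)]
  obtain ⟨Q, hQ, hfQ⟩ := exists_bilin_of_homogeneous isOpen_univ (Set.mem_univ _) hfs (by
    intro s _ t ht ht1
    have h := T.homothety scale 0 one_pos (isMetricOn_minkM n _)
      (isFormOn_const_toForm _ (hskew s)) ht.ne' (by rwa [abs_of_pos ht]) a b
    rw [hball] at h
    rw [← h, ← hball, abs_of_pos ht]
    congr 2
    ext y v
    simp only [toForm, hA, Matrix.of_apply, Pi.smul_apply, smul_eq_mul]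
    ring)
  set L : Matrix (Fin (n + 1)) (Fin (n + 1)) ℝ →ₗ[ℝ] (Fin m → ℝ) :=
    { toFun := fun F k => F (e.symm k).1 (e.symm k).2
      map_add' := fun _ _ => rfl
      map_smul' := fun _ _ => rfl } with hL
  set Q' : (Fin m → ℝ) →ₗ[ℝ] (Fin m → ℝ) →ₗ[ℝ] ℝ :=
    (ContinuousLinearMap.coeLM ℝ).comp Q.toLinearMap with hQ'
  refine ⟨Q'.compl₁₂ L L, fun F G => hQ _ _, fun F hF => ?_⟩
  have hLe : ∀ i j, L F (e (i, j)) = F i j := fun i j => by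
    change F (e.symm (e (i, j))).1 (e.symm (e (i, j))).2 = _
    rw [e.symm_apply_apply]
  have hAL : A (L F) = F := by
    ext i j
    simp only [hA, Matrix.of_apply, hLe]
    rw [hF j i]
    ring
  exact (hfQ (L F) (Set.mem_univ _)).symm.trans (by rw [hf]; simp only [hAL])

theorem minkM_mul_self (n : ℕ) : Matrix.of (minkM n) * Matrix.of (minkM n) = 1 := by
  have h : Matrix.of (minkM n) = Matrix.diagonal (eps n) := by
    ext i j
    rw [Matrix.of_apply, minkM, Matrix.diagonal_apply]
  rw [h, Matrix.diagonal_mul_diagonal]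
  simp only [eps_mul_self, Matrix.diagonal_one]

theorem ginv_minkM (n : ℕ) (x : Pt n) (a b : Fin (n + 1)) :
    ginv n (fun _ => minkM n) x a b = minkM n a b := by
  have h : ginv n (fun _ => minkM n) x = Matrix.of (minkM n) :=
    Matrix.inv_eq_left_inv (minkM_mul_self n)
  rw [h, Matrix.of_apply]

theorem pd_const (n : ℕ) (a : Fin (n + 1)) (c : ℝ) (x : Pt n) : pd n a (fun _ => c) x = 0 := by
  simp [pd]

theorem christoffel_minkM (n : ℕ) (x : Pt n) (c a b : Fin (n + 1)) :
    christoffel n (fun _ => minkM n) x c a b = 0 := by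
  simp [christoffel, pd_const]

theorem divT_minkM (n : ℕ) (t : Pt n → Fin (n + 1) → Fin (n + 1) → ℝ) (x : Pt n)
    (b : Fin (n + 1)) :
    divT n (fun _ => minkM n) t x b = ∑ a, eps n a * pd n a (fun y => t y a b) x := by
  simp [divT, christoffel_minkM, ginv_minkM, minkM]

theorem codiff_minkM (n : ℕ) (A : Pt n → Matrix (Fin (n + 1)) (Fin (n + 1)) ℝ) (x : Pt n)
    (v : Fin (2 - 1) → Fin (n + 1)) :
    codiff n 2 (fun _ => minkM n) (fun y => toForm n (A y)) x v =
      -∑ a, eps n a * pd n a (fun y => A y a (v ⟨0, by norm_num⟩)) x := by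
  have h : ∀ a y, toForm n (A y) (dcons 2 a v) = A y a (v ⟨0, by norm_num⟩) := fun _ _ => rfl
  simp [codiff, covd, christoffel_minkM, ginv_minkM, minkM, h]

theorem iCodiff_minkM (n : ℕ) (A : Pt n → Matrix (Fin (n + 1)) (Fin (n + 1)) ℝ) (x : Pt n)
    (b : Fin (n + 1)) :
    iCodiff n 2 (fun _ => minkM n) (fun y => toForm n (A y)) x b =
      -∑ a, ∑ j, eps n a * eps n j * pd n a (fun y => A y a j) x * A x j b := by
  have hsum : ∀ f : (Fin (2 - 1) → Fin (n + 1)) → ℝ, ∑ v, f v = ∑ i, f fun _ => i := fun f =>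
    ((Equiv.funUnique (Fin 1) (Fin (n + 1))).symm.sum_comp f).symm
  have hprod : ∀ f : Fin (2 - 1) → ℝ, ∏ j, f j = f ⟨0, by norm_num⟩ := fun f =>
    Fin.prod_univ_one f
  have hF : ∀ i, toForm n (A x) (dsnoc 2 (fun _ => i) b) = A x i b := fun _ => rfl
  simp only [iCodiff, hsum, hprod, codiff_minkM, ginv_minkM, hF, minkM, ite_mul, zero_mul,
    Finset.sum_ite_eq, Finset.mem_univ, if_true]
  rw [Finset.sum_comm, ← Finset.sum_neg_distrib]
  simp only [Nat.add_one_sub_one, Nat.factorial_one, Nat.cast_one, div_one, one_mul]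
  refine Finset.sum_congr rfl fun j _ => ?_
  simp only [mul_neg, neg_mul, Finset.mul_sum, Finset.sum_mul, neg_inj]
  refine Finset.sum_congr rfl fun a _ => ?_
  ring

theorem dext_toForm (n : ℕ) (A : Pt n → Matrix (Fin (n + 1)) (Fin (n + 1)) ℝ) (x : Pt n)
    (u : Fin 3 → Fin (n + 1)) :
    dext n 2 (fun y => toForm n (A y)) x u =
      pd n (u 0) (fun y => A y (u 1) (u 2)) x - pd n (u 1) (fun y => A y (u 0) (u 2)) x
        + pd n (u 2) (fun y => A y (u 0) (u 1)) x := by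
  have h : ∀ y, toForm n (A y) (u ∘ Fin.succAbove 0) = A y (u 1) (u 2) ∧
      toForm n (A y) (u ∘ Fin.succAbove 1) = A y (u 0) (u 2) ∧
      toForm n (A y) (u ∘ Fin.succAbove 2) = A y (u 0) (u 1) := fun _ => ⟨rfl, rfl, rfl⟩
  refine (Fin.sum_univ_three _).trans ?_
  simp only [h]
  norm_num
  ring

theorem pd_affine (n : ℕ) (a : Fin (n + 1)) (c : ℝ) (h : Fin (n + 1) → ℝ) (x : Pt n) :
    pd n a (fun y => c + ∑ i, y i * h i) x = h a := by
  have hd : HasFDerivAt (fun y : Pt n => c + ∑ i, y i * h i)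
      (∑ i, h i • ContinuousLinearMap.proj (R := ℝ) (φ := fun _ : Fin (n + 1) => ℝ) i) x :=
    (HasFDerivAt.fun_sum fun i _ => (hasFDerivAt_apply i x).mul_const (h i)).const_add c
  simp [pd, hd.fderiv, Pi.single_apply]

theorem pd_quadratic (n : ℕ) (a : Fin (n + 1)) {V : Type*} [AddCommGroup V] [Module ℝ V]
    (β : V →ₗ[ℝ] V →ₗ[ℝ] ℝ) (symm : ∀ F G, β F G = β G F) (F : V) (H : Fin (n + 1) → V) :
    pd n a (fun y => β (F + ∑ c, y c • H c) (F + ∑ c, y c • H c)) 0 = 2 * β F (H a) := by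
  have hd : DifferentiableAt ℝ
      (fun y : Pt n => β (F + ∑ c, y c • H c) (F + ∑ c, y c • H c)) 0 := by
    simp only [map_add, map_sum, map_smul, LinearMap.add_apply, LinearMap.sum_apply,
      LinearMap.smul_apply, smul_eq_mul]
    fun_prop
  rw [pd, ← hd.lineDeriv_eq_fderiv, lineDeriv]
  have hline : ∀ t : ℝ, β (F + ∑ c, (0 + t • Pi.single a 1 : Pt n) c • H c)
      (F + ∑ c, (0 + t • Pi.single a 1 : Pt n) c • H c) =
      β F F + t * (2 * β F (H a)) + t ^ 2 * β (H a) (H a) := fun t => by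
    have : ∑ c, (0 + t • Pi.single a 1 : Pt n) c • H c = t • H a := by
      rw [Finset.sum_eq_single a]
      · simp
      · intro c _ hc
        simp [hc]
      · simp
    rw [this]
    simp only [map_add, map_smul, LinearMap.add_apply, LinearMap.smul_apply, smul_eq_mul,
      symm (H a) F]
    ring
  simp only [hline]
  have h := (((hasDerivAt_id (0 : ℝ)).mul_const (2 * β F (H a))).const_add (β F F)).add
    ((hasDerivAt_pow 2 (0 : ℝ)).mul_const (β (H a) (H a)))
  exact h.deriv.trans (by simp)

theorem sum_diagonal {ι : Type*} [Fintype ι] [DecidableEq ι] (s : ι → ℝ) (u : ι → ι → ℝ)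
    (a b : ι) : ∑ c, ∑ d, Matrix.diagonal s c a * Matrix.diagonal s d b * u c d =
      s a * s b * u a b := by
  simp [Matrix.diagonal_apply]

/-- A natural tensor satisfying the three axioms agrees with the electromagnetic energy tensor on
constant data over Minkowski space. -/
theorem NaturalTensor.eq_energyForm {n : ℕ} (T : NaturalTensor n 2)
    (scale : ∀ W g F, IsOpen W → IsMetricOn n W g → IsFormOn n 2 W F →
      ∀ lam : ℝ, 0 < lam → ∀ x ∈ W, ∀ a b,
        T.T W (fun y c d => lam ^ 2 * g y c d) (fun y v => lam * F y v) x a b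
          = T.T W g F x a b)
    (vanish : ∀ W g F, IsOpen W → IsMetricOn n W g → IsFormOn n 2 W F →
      ∀ x ∈ W, (∀ v, F x v = 0) → ∀ a b, T.T W g F x a b = 0)
    (divcond : ∀ W g F, IsOpen W → IsMetricOn n W g → IsFormOn n 2 W F →
      (∀ x ∈ W, ∀ u, dext n 2 F x u = 0) →
      ∀ x ∈ W, ∀ b, divT n g (T.T W g F) x b = - iCodiff n 2 g F x b)
    {F : Matrix (Fin (n + 1)) (Fin (n + 1)) ℝ} (hF : ∀ i j, F i j = -F j i)
    (a b : Fin (n + 1)) :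
    T.T Set.univ (fun _ => minkM n) (fun _ => toForm n F) 0 a b = energyForm n a b F F := by
  choose β symm hβ using T.exists_bilin scale
  rw [← hβ a b F hF]
  refine Paper.eq_energyForm n β symm ?_ ?_ F hF a b
  · intro F H hF hH hcyc b
    set A : Pt n → Matrix (Fin (n + 1)) (Fin (n + 1)) ℝ := fun y => F + ∑ c, y c • H c with hA
    have hAe : ∀ y i j, A y i j = F i j + ∑ c, y c * H c i j := fun y i j => by
      simp [hA, Matrix.sum_apply]
    have hskew : ∀ y i j, A y i j = -A y j i := fun y i j => by
      rw [hAe, hAe, hF i j, neg_add, ← Finset.sum_neg_distrib]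
      simp only [hH _ i j, mul_neg]
    have hform : IsFormOn n 2 Set.univ (fun y => toForm n (A y)) :=
      isFormOn_toForm (fun i j => ContDiff.contDiffOn (by simp only [hAe]; fun_prop))
        fun y _ => hskew y
    have hT : ∀ y c, T.T Set.univ (fun _ => minkM n) (fun y => toForm n (A y)) y c b =
        β c b (A y) (A y) := fun y c => by
      rw [T.eq_const scale vanish isOpen_univ (isMetricOn_minkM n _) hform (Set.mem_univ y),
        T.const_translation y 0 (isMetricOn_minkM n _) (hskew y), hβ c b _ (hskew y)]
    have h := divcond Set.univ _ _ isOpen_univ (isMetricOn_minkM n _) hform (by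
      intro y _ u
      rw [dext_toForm]
      simp only [hAe, pd_affine]
      linarith [hcyc (u 0) (u 1) (u 2), hH (u 1) (u 2) (u 0)]) 0 (Set.mem_univ _) b
    rw [divT_minkM, iCodiff_minkM, neg_neg] at h
    simp only [hT] at h
    simp only [hAe, pd_affine, Pi.zero_apply, zero_mul, Finset.sum_const_zero, add_zero] at h
    simp only [hA, pd_quadratic n _ _ (symm _ b)] at h
    rw [← h, Finset.mul_sum]
    refine Finset.sum_congr rfl fun a _ => ?_
    ring
  · intro r a b ha hb F hF
    set s : Fin (n + 1) → ℝ := fun i => if i = r then -1 else 1 with hs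
    have hss : ∀ i, s i * s i = 1 := fun i => by simp only [hs]; split_ifs <;> norm_num
    have hdet : IsUnit (Matrix.diagonal s).det := by
      rw [Matrix.det_diagonal, isUnit_iff_ne_zero, Finset.prod_ne_zero_iff]
      exact fun i _ h => by simpa [h] using hss i
    have h := T.natural_const hdet 0 0 (isMetricOn_minkM n _) hF a b
    have hsF : ∀ i j, ∑ c, ∑ d, Matrix.diagonal s c i * Matrix.diagonal s d j * F c d =
        s i * s j * F i j := sum_diagonal s fun c d => F c d
    simp only [sum_diagonal, hsF] at h
    have hmink : (fun a b => s a * s b * minkM n a b) = minkM n := by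
      ext a b
      unfold minkM
      split_ifs with hab
      · rw [hab, hss, one_mul]
      · simp
    rw [hmink, ← hβ a b F hF] at h
    rw [hβ a b _ (fun i j => by simp only [Matrix.of_apply]; rw [hF i j]; ring)]
    rw [h]
    simp [hs, ha, hb]

/-- The electromagnetic energy tensor of a bilinear form with matrix `Φ`, for a metric with
matrix `G` and inverse `K`. -/
noncomputable def emTensor {ι : Type*} [Fintype ι] (K G Φ : Matrix ι ι ℝ) : Matrix ι ι ℝ :=
  -(Φ * K * Φ.transpose) + (1 / 4 * (Φ * K * Φ.transpose * K.transpose).trace) • G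

theorem emTensor_apply {ι : Type*} [Fintype ι] (K G Φ : Matrix ι ι ℝ) (a b : ι) :
    emTensor K G Φ a b = -((∑ i, ∑ i', K i i' * Φ a i * Φ b i')
      - (1 / 4) * (∑ i, ∑ i', ∑ j, ∑ j', K i i' * K j j' * Φ i j * Φ i' j') * G a b) := by
  have h : ∀ a b, (Φ * K * Φ.transpose) a b = ∑ i, ∑ i', K i i' * Φ a i * Φ b i' := fun a b => by
    simp only [Matrix.mul_apply, Matrix.transpose_apply, Finset.sum_mul]
    rw [Finset.sum_comm]
    exact Finset.sum_congr rfl fun i _ => Finset.sum_congr rfl fun j _ => by ring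
  have htr : (Φ * K * Φ.transpose * K.transpose).trace =
      ∑ i, ∑ i', ∑ j, ∑ j', K i i' * K j j' * Φ i j * Φ i' j' := by
    rw [Matrix.trace]
    simp only [Matrix.diag, Matrix.mul_apply (N := K.transpose), h, Matrix.transpose_apply,
      Finset.sum_mul]
    refine Finset.sum_congr rfl fun i _ => Finset.sum_congr rfl fun i' _ =>
      Finset.sum_congr rfl fun j _ => Finset.sum_congr rfl fun j' _ => by ring
  rw [emTensor, Matrix.add_apply, Matrix.neg_apply, Matrix.smul_apply, h, htr, smul_eq_mul]
  ring

theorem emTensor_congr {ι : Type*} [Fintype ι] (P K G Φ : Matrix ι ι ℝ) :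
    emTensor K (P.transpose * G * P) (P.transpose * Φ * P) =
      P.transpose * emTensor (P * K * P.transpose) G Φ * P := by
  have h : P.transpose * Φ * P * K * (P.transpose * Φ * P).transpose =
      P.transpose * (Φ * (P * K * P.transpose) * Φ.transpose) * P := by
    simp only [Matrix.transpose_mul, Matrix.transpose_transpose, Matrix.mul_assoc]
  have htr : (P.transpose * (Φ * (P * K * P.transpose) * Φ.transpose) * P * K.transpose).trace =
      (Φ * (P * K * P.transpose) * Φ.transpose * (P * K * P.transpose).transpose).trace := by
    rw [Matrix.mul_assoc, Matrix.mul_assoc, Matrix.trace_mul_comm]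
    simp only [Matrix.transpose_mul, Matrix.transpose_transpose, Matrix.mul_assoc]
  simp only [emTensor, h, htr, Matrix.mul_add, Matrix.add_mul, Matrix.mul_neg, Matrix.neg_mul,
    Matrix.mul_smul, Matrix.smul_mul]

theorem energyForm_eq_emTensor (n : ℕ) (a b : Fin (n + 1))
    (F : Matrix (Fin (n + 1)) (Fin (n + 1)) ℝ) :
    energyForm n a b F F = emTensor (.of (minkM n)) (.of (minkM n)) F a b := by
  rw [emTensor_apply, energyForm]
  simp only [Matrix.of_apply, minkM, ite_mul, mul_ite, zero_mul, mul_zero, Finset.sum_ite_eq,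
    Finset.mem_univ, if_true, Finset.sum_ite_irrel, Finset.sum_const_zero]
  rw [Finset.mul_sum]
  have h : ∀ i, -(1 / 2) * (eps n i * (F a i * F b i + F a i * F b i)) =
      -(eps n i * F a i * F b i) := fun i => by ring
  simp only [h, Finset.sum_neg_distrib]
  split_ifs <;> ring

theorem transpose_mul_mul_apply {ι : Type*} [Fintype ι] (P A : Matrix ι ι ℝ) (a b : ι) :
    (P.transpose * A * P) a b = ∑ c, ∑ d, P c a * P d b * A c d := by
  simp only [Matrix.mul_apply, Matrix.transpose_apply, Finset.sum_mul]
  rw [Finset.sum_comm]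
  exact Finset.sum_congr rfl fun i _ => Finset.sum_congr rfl fun j _ => by ring

/-- characterization of the electromagnetic energy tensor of a 2-form. -/
theorem statement0 (n : ℕ) (hn : 1 ≤ n) (T : NaturalTensor n 2)
    (scale : ∀ W g F, IsOpen W → IsMetricOn n W g → IsFormOn n 2 W F →
      ∀ lam : ℝ, 0 < lam → ∀ x ∈ W, ∀ a b,
        T.T W (fun y c d => lam ^ 2 * g y c d) (fun y v => lam * F y v) x a b
          = T.T W g F x a b)
    (vanish : ∀ W g F, IsOpen W → IsMetricOn n W g → IsFormOn n 2 W F →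
      ∀ x ∈ W, (∀ v, F x v = 0) → ∀ a b, T.T W g F x a b = 0)
    (divcond : ∀ W g F, IsOpen W → IsMetricOn n W g → IsFormOn n 2 W F →
      (∀ x ∈ W, ∀ u, dext n 2 F x u = 0) →
      ∀ x ∈ W, ∀ b, divT n g (T.T W g F) x b = - iCodiff n 2 g F x b) :
    ∀ W g F, IsOpen W → IsMetricOn n W g → IsFormOn n 2 W F →
      ∀ x ∈ W, ∀ a b,
        T.T W g F x a b =
          -((∑ i, ∑ i', ginv n g x i i' * F x ![a, i] * F x ![b, i'])
            - (1 / 4) * (∑ i, ∑ i', ∑ j, ∑ j',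
                ginv n g x i i' * ginv n g x j j' * F x ![i, j] * F x ![i', j'])
              * g x a b) := by
  intro W g F hW hg hF x hx a b
  obtain ⟨P, hP, hPg⟩ := (hg.2 x hx).2
  set G : Matrix (Fin (n + 1)) (Fin (n + 1)) ℝ := .of fun a b => g x a b with hG
  set Φ : Matrix (Fin (n + 1)) (Fin (n + 1)) ℝ := .of fun a b => F x ![a, b] with hΦ
  set η : Matrix (Fin (n + 1)) (Fin (n + 1)) ℝ := .of (minkM n) with hη
  have hskew : ∀ i j, Φ i j = -Φ j i := fun i j => hF.skew hx i j
  have hPη : P.transpose * G * P = η := by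
    ext a b
    rw [transpose_mul_mul_apply]
    refine Eq.trans ?_ (hPg a b)
    exact Finset.sum_congr rfl fun c _ => Finset.sum_congr rfl fun d _ => mul_right_comm _ _ _
  have hηη : η * η = 1 := minkM_mul_self n
  have hK : ginv n g x = P * η * P.transpose := by
    refine Matrix.inv_eq_right_inv ?_
    have h : P.transpose * (G * P * η) = 1 := by
      rw [← hηη, ← hPη]
      simp only [Matrix.mul_assoc]
    rw [mul_eq_one_comm] at h
    simpa only [Matrix.mul_assoc] using h
  set t : Matrix (Fin (n + 1)) (Fin (n + 1)) ℝ := .of (T.T W g F x) with ht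
  have hT : P.transpose * t * P = P.transpose * emTensor (ginv n g x) G Φ * P := by
    rw [hK, ← emTensor_congr, hPη]
    ext a b
    have hskew' : ∀ i j, (P.transpose * Φ * P) i j = -(P.transpose * Φ * P) j i := fun i j => by
      have hΦt : Φ.transpose = -Φ := Matrix.ext fun i j => hskew j i
      have h : (P.transpose * Φ * P).transpose = -(P.transpose * Φ * P) := by
        simp [Matrix.transpose_mul, hΦt, Matrix.mul_assoc]
      exact congrFun (congrFun h j) i
    have h := T.natural_const hP 0 x (hg.const hx _) hskew a b
    have hmet : (fun a b => ∑ c, ∑ d, P c a * P d b * g x c d) = minkM n := by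
      ext a b
      rw [← Matrix.of_apply (minkM n), ← hη, ← hPη, transpose_mul_mul_apply]
      rfl
    have hform : (Matrix.of fun i j => ∑ c, ∑ d, P c i * P d j * Φ c d) =
        P.transpose * Φ * P := by
      ext i j
      rw [transpose_mul_mul_apply]
      rfl
    rw [hmet, hform, T.eq_energyForm scale vanish divcond hskew', energyForm_eq_emTensor] at h
    rw [h, transpose_mul_mul_apply]
    refine Finset.sum_congr rfl fun c _ => Finset.sum_congr rfl fun d _ => ?_
    rw [ht, Matrix.of_apply, T.eq_const scale vanish hW hg hF hx, eq_toForm (F x)]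
  have hPt : IsUnit P.transpose.det := by rwa [Matrix.det_transpose]
  have hfinal : t = emTensor (ginv n g x) G Φ := by
    have h := congrArg (fun A => P.transpose⁻¹ * A * P⁻¹) hT
    simpa only [Matrix.mul_assoc, Matrix.mul_nonsing_inv P hP, Matrix.mul_one,
      Matrix.nonsing_inv_mul_cancel_left _ _ hPt] using h
  rw [← Matrix.of_apply (T.T W g F x), ← ht, hfinal, emTensor_apply]
  rfl
end Paper
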